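/- arXiv:2005.13869 — 2 statements merged into one kernel-verified Lean document; each statement's English description precedes it below -/
import Mathlib

section
/- Every t-cycle in S_t lies in a unique maximal nilpotent subgroup of S_t. -/
theorem Group.isNilpotent_of_injective {G H : Type*} [Group G] [Group H] [Group.IsNilpotent H]
    (f : G →* H) (hf : Function.Injective f) : Group.IsNilpotent G :=
  Subgroup.isNilpotent_of_ker_le_center f
    (by rw [(MonoidHom.ker_eq_bot_iff f).2 hf]; exact bot_le)

/-- A nontrivial normal subgroup of a nilpotent group meets the center nontrivially. -/
theorem Group.IsNilpotent.exists_mem_center_of_normal {G : Type*} [Group G] [Group.IsNilpotent G]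
    (K : Subgroup G) [K.Normal] (hK : K ≠ ⊥) : ∃ x ∈ K, x ≠ 1 ∧ x ∈ Subgroup.center G := by
  have key : ∀ n : ℕ, (∃ x ∈ K, x ≠ 1 ∧ x ∈ Subgroup.upperCentralSeries G n) →
      ∃ x ∈ K, x ≠ 1 ∧ x ∈ Subgroup.center G := by
    intro n
    induction n with
    | zero =>
      rintro ⟨x, -, hx1, hx⟩
      exact absurd (by simpa using hx) hx1
    | succ n ih =>
      rintro ⟨x, hxK, hx1, hx⟩
      by_cases h : ∃ x ∈ K, x ≠ 1 ∧ x ∈ Subgroup.upperCentralSeries G n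
      · exact ih h
      · refine ⟨x, hxK, hx1, Subgroup.mem_center_iff.2 fun y => ?_⟩
        have hy := Subgroup.mem_upperCentralSeries_succ_iff.1 hx y
        by_contra hne
        refine h ⟨_, ?_, ?_, hy⟩
        · have : x * y * x⁻¹ * y⁻¹ = x * (y * x⁻¹ * y⁻¹) := by group
          change x * y * x⁻¹ * y⁻¹ ∈ K
          rw [this]
          exact K.mul_mem hxK (‹K.Normal›.conj_mem _ (K.inv_mem hxK) y)
        · intro h1
          exact hne (commutatorElement_eq_one_iff_mul_comm.1 h1).symm
  obtain ⟨n, hn⟩ := Group.IsNilpotent.nilpotent G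
  obtain ⟨x, hx, hx1⟩ := K.bot_or_exists_ne_one.resolve_left hK
  exact key n ⟨x, hx, hx1, hn ▸ Subgroup.mem_top _⟩

/-- The center of a finite nilpotent group contains an element of every prime order
dividing the order of the group. -/
theorem Group.IsNilpotent.exists_orderOf_eq_mem_center {G : Type*} [Group G] [Finite G]
    [Group.IsNilpotent G] (p : ℕ) [Fact p.Prime] (hp : p ∣ Nat.card G) :
    ∃ x ∈ Subgroup.center G, orderOf x = p := by
  let P : Sylow p G := default
  obtain ⟨x, hxP, hx1, hx⟩ := exists_mem_center_of_normal (P : Subgroup G)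
    (P.ne_bot_of_dvd_card hp)
  obtain ⟨k, hk⟩ := IsPGroup.iff_orderOf.1 P.2 ⟨x, hxP⟩
  rw [Subgroup.orderOf_mk] at hk
  have hk0 : k ≠ 0 := by
    rintro rfl
    exact hx1 (orderOf_eq_one_iff.1 (by simpa using hk))
  obtain ⟨k, rfl⟩ := Nat.exists_eq_succ_of_ne_zero hk0
  refine ⟨x ^ p ^ k, Subgroup.pow_mem _ hx _, ?_⟩
  have hp0 := (Fact.out : p.Prime).pos
  rw [orderOf_pow_of_dvd (pow_pos hp0 k).ne' (by rw [hk]; exact pow_dvd_pow p k.le_succ), hk,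
    Nat.succ_eq_add_one, pow_succ, Nat.mul_div_cancel_left _ (pow_pos hp0 k)]

/-- In a finite cyclic group an element of prime order `p` is unique up to powers. -/
theorem pow_orderOf_div_mem_zpowers {G : Type*} [Group G] [Finite G] {g x : G} {p : ℕ}
    (hp : p.Prime) (hx : x ∈ Subgroup.zpowers g) (hxp : orderOf x = p) :
    p ∣ orderOf g ∧ g ^ (orderOf g / p) ∈ Subgroup.zpowers x := by
  have hdvd : p ∣ orderOf g := hxp ▸ orderOf_dvd_of_mem_zpowers hx
  refine ⟨hdvd, ?_⟩
  have hg0 := orderOf_pos g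
  obtain ⟨m, hm⟩ := hdvd
  have hm0 : 0 < m := by
    rcases Nat.eq_zero_or_pos m with rfl | h
    · exact absurd hm (by simpa using hg0.ne')
    · exact h
  have hdiv : orderOf g / p = m := by rw [hm, Nat.mul_div_cancel_left _ hp.pos]
  rw [hdiv]
  have hz : orderOf (g ^ m) = p := by
    rw [orderOf_pow_of_dvd hm0.ne' ⟨p, by rw [hm, mul_comm]⟩, hm, Nat.mul_div_cancel _ hm0]
  obtain ⟨k, rfl⟩ := hx
  have hk : g ^ (k * p) = 1 := by
    have := pow_orderOf_eq_one (g ^ k)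
    rw [show orderOf (g ^ k) = p from hxp] at this
    rw [zpow_mul]; exact_mod_cast this
  have h1 : (m : ℤ) ∣ k := by
    have := orderOf_dvd_iff_zpow_eq_one.2 hk
    rw [hm, mul_comm k, Nat.cast_mul] at this
    exact Int.dvd_of_mul_dvd_mul_left (by exact_mod_cast hp.ne_zero) this
  have hle : Subgroup.zpowers (g ^ k) ≤ Subgroup.zpowers (g ^ m) := by
    obtain ⟨j, rfl⟩ := h1
    rw [Subgroup.zpowers_le]
    exact ⟨j, by simp [zpow_mul]⟩
  have := Subgroup.eq_of_le_of_card_ge hle (by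
    rw [Nat.card_zpowers, Nat.card_zpowers, hz]; exact hxp.ge)
  exact this ▸ Subgroup.mem_zpowers _

namespace Equiv.Perm

variable {X : Type*}

/-- A permutation commuting with a full cycle is a power of it. -/
theorem mem_zpowers_of_commute_of_sameCycle {g h : Perm X} (hg : ∀ x y, g.SameCycle x y)
    (hc : Commute g h) : h ∈ Subgroup.zpowers g := by
  rcases isEmpty_or_nonempty X with _ | ⟨⟨x⟩⟩
  · exact Subsingleton.elim (1 : Perm X) h ▸ one_mem _
  obtain ⟨k, hk⟩ := hg x (h x)
  refine ⟨k, Equiv.ext fun y => ?_⟩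
  obtain ⟨i, rfl⟩ := hg x y
  have h1 : h ((g ^ i) x) = (g ^ i) (h x) := by
    rw [← mul_apply, ← mul_apply, ((hc.zpow_left i).eq)]
  rw [h1, ← hk, ← mul_apply, ← mul_apply]
  exact congrArg (fun f : Perm X => f x) (Commute.refl g |>.zpow_zpow k i).eq

/-- The centralizer of `z` permutes the cycles of `z`. -/
def centralizerToPermCycles (z : Perm X) :
    Subgroup.centralizer {z} →* Perm (Quotient (SameCycle.setoid z)) :=
  letI : MulAction (Subgroup.centralizer {z}) (Quotient (SameCycle.setoid z)) :=
    { smul := fun h => Quotient.map h.1 (by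
        rintro x y ⟨k, rfl⟩
        refine ⟨k, ?_⟩
        have hc : Commute z h.1 := (Subgroup.mem_centralizer_singleton_iff.1 h.2).symm
        rw [← mul_apply, ← mul_apply, (hc.zpow_left k).eq])
      one_smul := by rintro ⟨x⟩; rfl
      mul_smul := by rintro a b ⟨x⟩; rfl }
  MulAction.toPermHom _ _

theorem centralizerToPermCycles_mk (z : Perm X) (h : Subgroup.centralizer {z}) (x : X) :
    centralizerToPermCycles z h (Quotient.mk _ x) = Quotient.mk _ (h.1 x) := rfl

theorem sameCycle_centralizerToPermCycles {z : Perm X} {g : Subgroup.centralizer {z}}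
    (hg : ∀ x y, g.1.SameCycle x y) (a b : Quotient (SameCycle.setoid z)) :
    (centralizerToPermCycles z g).SameCycle a b := by
  induction a using Quotient.inductionOn with | _ x
  induction b using Quotient.inductionOn with | _ y
  obtain ⟨k, hk⟩ := hg x y
  refine ⟨k, ?_⟩
  rw [← map_zpow, centralizerToPermCycles_mk, Subgroup.coe_zpow, hk]

theorem pow_eq_one_of_centralizerToPermCycles_eq_one {z : Perm X} {h : Subgroup.centralizer {z}}
    (hh : centralizerToPermCycles z h = 1) {n : ℕ} (hz : z ^ n = 1) : h ^ n = 1 := by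
  refine Subtype.ext (Equiv.ext fun x => ?_)
  have hx : z.SameCycle x (h.1 x) := by
    have := centralizerToPermCycles_mk z h x
    rw [hh] at this
    exact Quotient.exact this
  obtain ⟨k, hk⟩ := hx
  have hc : Commute z h.1 := (Subgroup.mem_centralizer_singleton_iff.1 h.2).symm
  have hi : ∀ i : ℕ, (h.1 ^ i) x = ((z ^ k) ^ i) x := by
    intro i
    induction i with
    | zero => rfl
    | succ i ih =>
      rw [pow_succ, mul_apply, ← hk, ← mul_apply, ((hc.zpow_left k).pow_right i).eq.symm,
        mul_apply, ih, ← mul_apply, ← pow_succ']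
  have hzk : (z ^ k) ^ n = 1 := by
    rw [← zpow_natCast, zpow_comm, zpow_natCast, hz, one_zpow]
  simpa [hzk] using hi n

theorem card_cycles_lt [Finite X] {z : Perm X} (hz : z ≠ 1) :
    Nat.card (Quotient (SameCycle.setoid z)) < Nat.card X := by
  refine lt_of_le_of_ne (Nat.card_le_card_of_surjective _ Quotient.mk_surjective) fun h => hz ?_
  have hinj : Function.Injective (Quotient.mk (SameCycle.setoid z)) :=
    ((Nat.bijective_iff_surjective_and_card _).2 ⟨Quotient.mk_surjective, h.symm⟩).1
  exact Equiv.ext fun x => (hinj (Quotient.sound ⟨1, by simp⟩)).symm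

/-- For a nilpotent group `N` of permutations containing a full cycle `g`, every prime `p` dividing
the order of `N` divides the order of `g`, and `N` centralizes the elements of order `p` in the group
generated by `g`. -/
theorem dvd_orderOf_of_isNilpotent [Finite X] {g : Perm X} (hg : ∀ x y, g.SameCycle x y)
    {N : Subgroup (Perm X)} (hN : Group.IsNilpotent N) (hgN : g ∈ N) {p : ℕ} (hp : p.Prime)
    (hpN : p ∣ Nat.card N) :
    p ∣ orderOf g ∧ N ≤ Subgroup.centralizer {g ^ (orderOf g / p)} := by
  have := Fact.mk hp
  obtain ⟨x, hx, hxp⟩ := Group.IsNilpotent.exists_orderOf_eq_mem_center (G := N) p hpN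
  have hxg : x.1 ∈ Subgroup.zpowers g := mem_zpowers_of_commute_of_sameCycle hg
    (congrArg Subtype.val (Subgroup.mem_center_iff.1 hx ⟨g, hgN⟩))
  obtain ⟨h1, h2⟩ := pow_orderOf_div_mem_zpowers hp hxg (by rw [Subgroup.orderOf_coe, hxp])
  refine ⟨h1, fun h hh => Subgroup.mem_centralizer_singleton_iff.2 ?_⟩
  obtain ⟨k, hk⟩ := h2
  have hc : Commute h x.1 := congrArg Subtype.val (Subgroup.mem_center_iff.1 hx ⟨h, hh⟩)
  rw [← hk]
  exact hc.zpow_right k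

/-- The subgroup generated by all nilpotent subgroups containing `g`. -/
def nilpotentHull (g : Perm X) : Subgroup (Perm X) :=
  sSup {N | Group.IsNilpotent N ∧ g ∈ N}

theorem le_nilpotentHull {g : Perm X} {N : Subgroup (Perm X)} (hN : Group.IsNilpotent N)
    (hgN : g ∈ N) : N ≤ nilpotentHull g :=
  le_sSup ⟨hN, hgN⟩

theorem mem_nilpotentHull (g : Perm X) : g ∈ nilpotentHull g :=
  le_nilpotentHull (N := Subgroup.zpowers g)
    (letI := IsCyclic.commGroup (α := Subgroup.zpowers g); CommGroup.isNilpotent) (Subgroup.mem_zpowers g)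
    (Subgroup.mem_zpowers g)

theorem nilpotentHull_le_centralizer [Finite X] {g : Perm X} (hg : ∀ x y, g.SameCycle x y) {p : ℕ}
    (hp : p.Prime) (hpg : p ∣ orderOf g) :
    nilpotentHull g ≤ Subgroup.centralizer {g ^ (orderOf g / p)} :=
  sSup_le fun N ⟨hN, hgN⟩ => (dvd_orderOf_of_isNilpotent hg hN hgN hp
    (hpg.trans (Subgroup.orderOf_dvd_natCard N hgN))).2

theorem centralizerToPermCycles_mem_nilpotentHull {g z : Perm X}
    (hz : nilpotentHull g ≤ Subgroup.centralizer {z}) {h : Perm X} (hh : h ∈ nilpotentHull g) :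
    centralizerToPermCycles z ⟨h, hz hh⟩ ∈
      nilpotentHull (centralizerToPermCycles z ⟨g, hz (mem_nilpotentHull g)⟩) := by
  set φ := centralizerToPermCycles z
  have key : nilpotentHull g ≤ ((nilpotentHull (φ ⟨g, hz (mem_nilpotentHull g)⟩)).comap φ).map
      (Subgroup.centralizer {z}).subtype := by
    refine sSup_le fun N ⟨hN, hgN⟩ n hn => ?_
    have hNz : N ≤ Subgroup.centralizer {z} := (le_nilpotentHull hN hgN).trans hz
    let ψ : N →* Perm (Quotient (SameCycle.setoid z)) := φ.comp (Subgroup.inclusion hNz)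
    have hψ : Group.IsNilpotent ψ.range :=
      Group.nilpotent_of_surjective ψ.rangeRestrict ψ.rangeRestrict_surjective
    exact ⟨⟨n, hNz hn⟩, le_nilpotentHull hψ ⟨⟨g, hgN⟩, rfl⟩ ⟨⟨n, hn⟩, rfl⟩, rfl⟩
  obtain ⟨a, ha, rfl⟩ := key hh
  exact ha

/-- The nilpotent subgroups containing a full cycle generate a nilpotent group. -/
theorem isNilpotent_nilpotentHull (X : Type*) [Finite X] (g : Perm X)
    (hg : ∀ x y, g.SameCycle x y) : Group.IsNilpotent (nilpotentHull g) := by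
  induction hn : Nat.card X using Nat.strong_induction_on generalizing X with
  | _ n ih
  subst hn
  have step : ∀ p : ℕ, p.Prime → p ∣ orderOf g →
      ∃ (hz : nilpotentHull g ≤ Subgroup.centralizer {g ^ (orderOf g / p)}),
        (g ^ (orderOf g / p)) ^ p = 1 ∧
        Group.IsNilpotent (nilpotentHull (centralizerToPermCycles (g ^ (orderOf g / p))
          ⟨g, hz (mem_nilpotentHull g)⟩)) := by
    intro p hp hpg
    refine ⟨nilpotentHull_le_centralizer hg hp hpg, ?_, ?_⟩
    · rw [← pow_mul, Nat.div_mul_cancel hpg, pow_orderOf_eq_one]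
    · refine ih _ (card_cycles_lt ?_) _ _ (sameCycle_centralizerToPermCycles hg) rfl
      exact pow_ne_one_of_lt_orderOf
        (Nat.div_pos (Nat.le_of_dvd (orderOf_pos g) hpg) hp.pos).ne'
        (Nat.div_lt_self (orderOf_pos g) hp.one_lt)
  by_cases h1 : orderOf g = 1
  · have hsub : Subsingleton X := ⟨fun x y => by
      obtain ⟨k, hk⟩ := hg x y
      simpa [orderOf_eq_one_iff.1 h1] using hk⟩
    infer_instance
  obtain ⟨p, hp, hpg⟩ := Nat.exists_prime_and_dvd h1
  obtain ⟨hz, hzp, hnil⟩ := step p hp hpg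
  set z := g ^ (orderOf g / p)
  let φ : nilpotentHull g →* nilpotentHull (centralizerToPermCycles z
      ⟨g, hz (mem_nilpotentHull g)⟩) :=
    ((centralizerToPermCycles z).comp (Subgroup.inclusion hz)).codRestrict _
      fun h => centralizerToPermCycles_mem_nilpotentHull hz h.2
  have hφ : ∀ h, φ h = 1 → h ^ p = 1 := fun h hh => by
    have := pow_eq_one_of_centralizerToPermCycles_eq_one (congrArg Subtype.val hh) hzp
    exact Subtype.ext (congrArg (fun k : Subgroup.centralizer {z} => k.1) this)
  by_cases hq : ∃ q : ℕ, q.Prime ∧ q ∣ orderOf g ∧ q ≠ p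
  · obtain ⟨q, hq, hqg, hne⟩ := hq
    obtain ⟨hw, hwq, hnil'⟩ := step q hq hqg
    set w := g ^ (orderOf g / q)
    let χ : nilpotentHull g →* nilpotentHull (centralizerToPermCycles w
        ⟨g, hw (mem_nilpotentHull g)⟩) :=
      ((centralizerToPermCycles w).comp (Subgroup.inclusion hw)).codRestrict _
        fun h => centralizerToPermCycles_mem_nilpotentHull hw h.2
    have hχ : ∀ h, χ h = 1 → h ^ q = 1 := fun h hh => by
      have := pow_eq_one_of_centralizerToPermCycles_eq_one (congrArg Subtype.val hh) hwq
      exact Subtype.ext (congrArg (fun k : Subgroup.centralizer {w} => k.1) this)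
    refine Group.isNilpotent_of_injective (φ.prod χ) ((injective_iff_map_eq_one _).2 fun h hh => ?_)
    have hdvd := Nat.dvd_gcd (orderOf_dvd_of_pow_eq_one (hφ h (congrArg Prod.fst hh)))
      (orderOf_dvd_of_pow_eq_one (hχ h (congrArg Prod.snd hh)))
    rw [((Nat.coprime_primes hp hq).2 hne.symm).gcd_eq_one] at hdvd
    exact orderOf_eq_one_iff.1 (Nat.dvd_one.1 hdvd)
  · push Not at hq
    have := Fact.mk hp
    have hP : IsPGroup p (nilpotentHull (centralizerToPermCycles z
        ⟨g, hz (mem_nilpotentHull g)⟩)) := by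
      refine IsPGroup.of_card (Nat.eq_prime_pow_of_unique_prime_dvd Nat.card_pos.ne'
        fun {q} hq' hqd => hq q hq' ?_)
      have := (dvd_orderOf_of_isNilpotent (sameCycle_centralizerToPermCycles hg) hnil
        (mem_nilpotentHull _) hq' hqd).1
      exact this.trans ((orderOf_map_dvd _ _).trans (Subgroup.orderOf_mk _ _).dvd)
    refine IsPGroup.isNilpotent (p := p) fun h => ?_
    obtain ⟨k, hk⟩ := hP (φ h)
    refine ⟨k + 1, ?_⟩
    rw [pow_succ, pow_mul]
    exact hφ _ (by rw [map_pow, hk])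

end Equiv.Perm

theorem t_cycle_unique_maximal_nilpotent (t : ℕ) (ht : 1 ≤ t)
    (g : Equiv.Perm (Fin t)) (hg : ∀ x y : Fin t, g.SameCycle x y) :
    ∃! N : Subgroup (Equiv.Perm (Fin t)),
      Group.IsNilpotent N ∧ g ∈ N ∧
        ∀ M : Subgroup (Equiv.Perm (Fin t)), Group.IsNilpotent M → N ≤ M → M = N := by
  have hnil := Equiv.Perm.isNilpotent_nilpotentHull _ g hg
  have hmem := Equiv.Perm.mem_nilpotentHull g
  refine ⟨Equiv.Perm.nilpotentHull g, ⟨hnil, hmem, fun M hM hle => ?_⟩, ?_⟩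
  · exact le_antisymm (Equiv.Perm.le_nilpotentHull hM (hle hmem)) hle
  · rintro N ⟨hN, hgN, hmax⟩
    exact (hmax _ hnil (Equiv.Perm.le_nilpotentHull hN hgN)).symm
end

section
/- If g ∈ S_n has cycle type given by a partition of n into distinct parts, then g lies in a unique maximal nilpotent subgroup of S_n. -/
section NilpotentGroups

variable {G : Type*} [Group G]

/-- In a finite nilpotent group whose order has largest `p'`-divisor `N`, the elements killed by
`N` are closed under multiplication. -/
theorem Group.IsNilpotent.mul_pow_ordCompl_eq_one [Finite G] [Group.IsNilpotent G] {p : ℕ}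
    (hp : p.Prime) {x y : G} (hx : x ^ (ordCompl[p] (Nat.card G)) = 1)
    (hy : y ^ (ordCompl[p] (Nat.card G)) = 1) : (x * y) ^ (ordCompl[p] (Nat.card G)) = 1 := by
  obtain ⟨e⟩ := (Group.isNilpotent_of_finite_tfae (G := G)).out 0 4 |>.mp ‹_›
  obtain ⟨f, rfl⟩ := e.surjective x
  obtain ⟨f', rfl⟩ := e.surjective y
  set N := ordCompl[p] (Nat.card G) with hN
  have hcop : Nat.Coprime p N := Nat.coprime_ordCompl hp Nat.card_pos.ne'
  rw [← map_pow, EmbeddingLike.map_eq_one_iff] at hx hy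
  rw [← map_mul, ← map_pow, EmbeddingLike.map_eq_one_iff]
  funext r P
  have hr : (r : ℕ).Prime := Nat.prime_of_mem_primeFactors r.2
  have := Fact.mk hr
  have key : ∀ u : P, u ^ N = 1 → (r : ℕ) = p → u = 1 := by
    intro u hu hrp
    obtain ⟨k, hk⟩ := P.isPGroup' u
    have h1 := Nat.dvd_gcd (orderOf_dvd_of_pow_eq_one hk) (orderOf_dvd_of_pow_eq_one hu)
    have hcop' : Nat.Coprime (r : ℕ) N := hrp ▸ hcop
    rw [(hcop'.pow_left k).gcd_eq_one] at h1
    exact orderOf_eq_one_iff.mp (Nat.dvd_one.mp h1)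
  by_cases hrp : (r : ℕ) = p
  · have h1 := key (f r P) (congrFun (congrFun hx r) P) hrp
    have h2 := key (f' r P) (congrFun (congrFun hy r) P) hrp
    simp [h1, h2]
  · have : ∀ u : P, u ^ N = 1 := by
      intro u
      obtain ⟨k, hk⟩ := IsPGroup.iff_orderOf.mp P.isPGroup' u
      apply orderOf_dvd_iff_pow_eq_one.mp
      have hd : orderOf u ∣ Nat.card G :=
        (orderOf_dvd_natCard u).trans (Subgroup.card_subgroup_dvd_card _)
      refine Nat.Coprime.dvd_of_dvd_mul_left ?_
        (hd.trans (Nat.ordProj_mul_ordCompl_eq_self (Nat.card G) p).symm.dvd)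
      rw [hk]
      exact Nat.Coprime.pow _ _ ((Nat.coprime_primes hr hp).mpr hrp)
    exact this _

/-- Induction along the upper central series of a nilpotent subgroup. -/
theorem Subgroup.induction_of_isNilpotent {M : Subgroup G} [Group.IsNilpotent M]
    {P : G → Prop} (one : P 1)
    (step : ∀ Z Z' : Subgroup G, Z' ≤ M → (∀ σ ∈ Z', ∀ y ∈ M, σ * y * σ⁻¹ * y⁻¹ ∈ Z) →
      (∀ τ ∈ Z, P τ) → ∀ σ ∈ Z', P σ) {σ : G} (hσ : σ ∈ M) : P σ := by
  obtain ⟨n, hn⟩ := Group.IsNilpotent.nilpotent M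
  have : ∀ j, ∀ σ ∈ (Subgroup.upperCentralSeries M j).map M.subtype, P σ := by
    intro j
    induction j with
    | zero => simpa using one
    | succ j ih =>
      refine step _ _ (Subgroup.map_subtype_le _) ?_ ih
      rintro _ ⟨σ, hσ, rfl⟩ y hy
      exact ⟨σ * ⟨y, hy⟩ * σ⁻¹ * ⟨y, hy⟩⁻¹,
        Subgroup.mem_upperCentralSeries_succ_iff.mp hσ ⟨y, hy⟩, rfl⟩
  exact this n σ ⟨⟨σ, hσ⟩, by simp [hn], rfl⟩

/-- If every element of a finite nilpotent group is a product of a power of `h` and an element of a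
subgroup `S`, and `h ^ p ^ a ∈ S`, then every conjugate of an element of `S` by `h` is a product of
a power of `h ^ p` and an element of `S`. -/
theorem Group.IsNilpotent.exists_dvd_zpow_mul_conj_mem [Finite G] [Group.IsNilpotent G] {p : ℕ}
    (hp : p.Prime) {S : Subgroup G} {h : G} (hS : ∀ τ, ∃ s : ℤ, h ^ s * τ ∈ S) {a : ℕ}
    (ha : h ^ p ^ a ∈ S) {ρ : G} (hρ : ρ ∈ S) :
    ∃ s : ℤ, (p : ℤ) ∣ s ∧ h ^ s * (h⁻¹ * ρ * h) ∈ S := by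
  rcases eq_or_ne S ⊤ with rfl | hne
  · exact ⟨0, by simp⟩
  obtain ⟨W, hW, hSW⟩ := (eq_top_or_exists_le_coatom S).resolve_left hne
  have hnorm : W.Normal :=
    Subgroup.NormalizerCondition.normal_of_coatom W Group.normalizerCondition_of_isNilpotent hW
  have hhW : h ∉ W := by
    intro hh
    refine hW.1 (eq_top_iff.mpr fun τ _ => ?_)
    obtain ⟨s, hs⟩ := hS τ
    exact (W.mul_mem_cancel_left (W.zpow_mem hh s)).mp (hSW hs)
  have hconj : h⁻¹ * ρ * h ∈ W := by
    simpa using hnorm.conj_mem ρ (hSW hρ) h⁻¹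
  obtain ⟨s, hs⟩ := hS (h⁻¹ * ρ * h)
  refine ⟨s, ?_, hs⟩
  have hsW : h ^ s ∈ W := (W.mul_mem_cancel_right hconj).mp (hSW hs)
  by_contra hps
  have hc : IsCoprime ((p : ℤ) ^ a) s :=
    ((Nat.prime_iff_prime_int.mp hp).coprime_iff_not_dvd.mpr hps).pow_left
  obtain ⟨u, v, huv⟩ := hc
  apply hhW
  have : h = (h ^ p ^ a) ^ u * (h ^ s) ^ v := by
    rw [← zpow_natCast h, ← zpow_mul, ← zpow_mul, ← zpow_add]
    push_cast
    rw [mul_comm _ u, mul_comm s, huv, zpow_one]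
  rw [this]
  exact W.mul_mem (W.zpow_mem (hSW ha) _) (W.zpow_mem hsW _)

end NilpotentGroups

namespace Equiv.Perm

variable {α : Type*} {g σ τ : Perm α} {m d : ℕ} {x y : α}

theorem sameCycle_pow_iff : (g ^ m).SameCycle x y ↔ ∃ s : ℤ, (g ^ (m * s : ℤ)) x = y := by
  simp [SameCycle, zpow_mul]

theorem sameCycle_pow_zpow_apply (k : ℤ) :
    (g ^ m).SameCycle ((g ^ k) x) ((g ^ k) y) ↔ (g ^ m).SameCycle x y := by
  simp only [sameCycle_pow_iff, ← mul_apply, ← zpow_add, add_comm _ k]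
  simp [zpow_add]

theorem sameCycle_pow_self_zpow {k : ℤ} (h : (m : ℤ) ∣ k) :
    (g ^ m).SameCycle x ((g ^ k) x) := by
  obtain ⟨s, rfl⟩ := h
  exact sameCycle_pow_iff.mpr ⟨s, rfl⟩

theorem SameCycle.of_pow_dvd (hd : d ∣ m) (h : (g ^ m).SameCycle x y) :
    (g ^ d).SameCycle x y := by
  obtain ⟨c, rfl⟩ := hd
  rw [pow_mul] at h
  exact h.of_pow

/-- A permutation commuting with `g ^ d` modulo the orbits of `g ^ m` also commutes with all powers
of `g ^ d` modulo these orbits. -/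
theorem sameCycle_pow_apply_zpow_comm
    (h : ∀ x, (g ^ m).SameCycle (σ ((g ^ d) x)) ((g ^ d) (σ x))) (k : ℤ) (x : α) :
    (g ^ m).SameCycle (σ ((g ^ (d * k : ℤ)) x)) ((g ^ (d * k : ℤ)) (σ x)) := by
  induction k using Int.induction_on generalizing x with
  | zero => simpa using SameCycle.refl _ _
  | succ k ih =>
    have e : g ^ (d * (k + 1) : ℤ) = g ^ (d * k : ℤ) * g ^ d := by
      rw [mul_add, mul_one, zpow_add, zpow_natCast]
    rw [e, mul_apply, mul_apply]
    exact (ih _).trans ((sameCycle_pow_zpow_apply _).mpr (h x))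
  | pred k ih =>
    have e : g ^ (d * (-k - 1) : ℤ) = g ^ (d * -k : ℤ) * (g ^ d)⁻¹ := by
      rw [mul_sub, mul_one, zpow_sub, zpow_natCast]
    rw [e, mul_apply, mul_apply]
    refine (ih _).trans ((sameCycle_pow_zpow_apply _).mpr ?_)
    rw [← sameCycle_pow_zpow_apply d]
    simpa using (h ((g ^ d)⁻¹ x)).symm

theorem SameCycle.pow_apply_of_comm (hd : d ∣ m)
    (h : ∀ x, (g ^ m).SameCycle (σ ((g ^ d) x)) ((g ^ d) (σ x)))
    (hxy : (g ^ m).SameCycle x y) : (g ^ m).SameCycle (σ x) (σ y) := by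
  obtain ⟨s, rfl⟩ := sameCycle_pow_iff.mp hxy
  obtain ⟨c, rfl⟩ := hd
  have h1 := sameCycle_pow_apply_zpow_comm h (c * s) x
  rw [← mul_assoc, ← Nat.cast_mul] at h1
  exact (sameCycle_pow_self_zpow (dvd_mul_right _ _)).trans h1.symm

theorem sameCycle_pow_apply_iterate
    (h : ∀ (t : ℕ) (x), (g ^ m).SameCycle ((σ ^ t) ((g ^ d) x)) ((g ^ d) ((σ ^ t) x)))
    {k : ℤ} (hk : σ x = (g ^ (d * k : ℤ)) x) (t : ℕ) :
    (g ^ m).SameCycle ((σ ^ t) x) ((g ^ (d * k * t : ℤ)) x) := by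
  induction t with
  | zero => simpa using SameCycle.refl _ _
  | succ t ih =>
    rw [pow_succ, mul_apply, hk]
    refine (sameCycle_pow_apply_zpow_comm (h t) k x).trans ?_
    have := (sameCycle_pow_zpow_apply (d * k : ℤ)).mpr ih
    rw [← mul_apply (g ^ (d * k : ℤ)) (g ^ (d * k * t : ℤ)), ← zpow_add] at this
    convert this using 4
    push_cast; ring

theorem sameCycle_pow_zpow_of_isCoprime {k N : ℤ} (hN : IsCoprime N m)
    (h : (g ^ m).SameCycle x ((g ^ (k * N)) x)) : (g ^ m).SameCycle x ((g ^ k) x) := by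
  obtain ⟨s, hs⟩ := sameCycle_pow_iff.mp h
  obtain ⟨u, v, huv⟩ := hN
  have h1 : (g ^ (k * N - m * s)) x = x := by
    rw [sub_eq_neg_add, zpow_add, mul_apply, ← hs, ← mul_apply, ← zpow_add, neg_add_cancel,
      zpow_zero, one_apply]
  have h2 := zpow_apply_eq_self_of_apply_eq_self h1 u
  refine sameCycle_pow_iff.mpr ⟨u * s + k * v, ?_⟩
  rw [← zpow_mul] at h2
  have e : k = m * (u * s + k * v) + (k * N - m * s) * u := by linear_combination -k * huv
  conv_rhs => rw [e, zpow_add, mul_apply, h2]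

/-- If orbits of `g` of equal size coincide, then every nilpotent permutation group containing `g`
preserves the orbits of `g`. -/
theorem sameCycle_apply_of_isNilpotent {M : Subgroup (Perm α)} [Group.IsNilpotent M]
    (hg : g ∈ M)
    (hdist : ∀ x y, Nat.card {z // g.SameCycle x z} = Nat.card {z // g.SameCycle y z} →
      g.SameCycle x y) (hσ : σ ∈ M) (x : α) : g.SameCycle x (σ x) := by
  refine Subgroup.induction_of_isNilpotent (M := M) (P := fun σ => ∀ x, g.SameCycle x (σ x))
    (fun _ => SameCycle.refl _ _) ?_ hσ x
  intro Z Z' _ hcomm hZ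
  have key : ∀ σ ∈ Z', ∀ x y, g.SameCycle x y → g.SameCycle (σ x) (σ y) := by
    intro σ hσ x y hxy
    rw [← pow_one g] at hxy ⊢
    refine hxy.pow_apply_of_comm dvd_rfl fun z => ?_
    simpa using (hZ _ (hcomm σ hσ g hg) (g (σ z))).symm
  intro σ hσ x
  refine hdist _ _ (Nat.card_congr (σ.subtypeEquiv fun z => ⟨key σ hσ x z, fun h => ?_⟩))
  simpa using key σ⁻¹ (inv_mem hσ) _ _ h

/-- The permutations preserving every orbit of `g` and commuting with `g ^ p ^ i` modulo the
orbits of `g ^ p ^ (i + 1)`, for all primes `p` and all `i`. -/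
def coherentSubmonoid (g : Perm α) : Submonoid (Perm α) where
  carrier := {σ | (∀ x, g.SameCycle x (σ x)) ∧ ∀ p : ℕ, p.Prime → ∀ (i : ℕ) (x : α),
    (g ^ p ^ (i + 1)).SameCycle (σ ((g ^ p ^ i) x)) ((g ^ p ^ i) (σ x))}
  one_mem' := ⟨fun _ => SameCycle.refl _ _, fun _ _ _ _ => SameCycle.refl _ _⟩
  mul_mem' {σ τ} hσ hτ := by
    refine ⟨fun x => (hτ.1 x).trans (hσ.1 (τ x)), fun p hp i x => ?_⟩
    exact ((hτ.2 p hp i x).pow_apply_of_comm (pow_dvd_pow p i.le_succ) (hσ.2 p hp i)).trans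
      (hσ.2 p hp i (τ x))

theorem SameCycle.apply_of_mem_coherentSubmonoid {p : ℕ} (hp : p.Prime)
    (hσ : σ ∈ coherentSubmonoid g) {i : ℕ} (h : (g ^ p ^ i).SameCycle x y) :
    (g ^ p ^ i).SameCycle (σ x) (σ y) := by
  cases i with
  | zero =>
    rw [pow_zero, pow_one] at h ⊢
    exact ((hσ.1 x).symm.trans h).trans (hσ.1 y)
  | succ i => exact h.pow_apply_of_comm (pow_dvd_pow p i.le_succ) (hσ.2 p hp i)

theorem sameCycle_pow_prime_pow_apply {p : ℕ} (hp : p.Prime) (hσ : σ ∈ coherentSubmonoid g)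
    (i : ℕ) (x : α) : (g ^ p ^ i).SameCycle x ((σ ^ p ^ i) x) := by
  induction i generalizing x with
  | zero => simpa using hσ.1 x
  | succ i ih =>
    obtain ⟨k, hk⟩ := sameCycle_pow_iff.mp (ih x)
    have h := sameCycle_pow_apply_iterate (σ := σ ^ p ^ i) (m := p ^ (i + 1))
      (fun t y => (pow_mem (pow_mem hσ _) t).2 p hp i y) hk.symm p
    rw [← pow_mul, ← pow_succ] at h
    refine (sameCycle_pow_self_zpow ⟨k, ?_⟩).trans h.symm
    push_cast; ring

/-- The subgroup of permutations preserving every orbit of `g` and commuting with `g ^ p ^ i`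
modulo the orbits of `g ^ p ^ (i + 1)`, for all primes `p` and all `i`. -/
def coherentSubgroup [Finite α] (g : Perm α) : Subgroup (Perm α) where
  __ := coherentSubmonoid g
  inv_mem' {σ} hσ := (Submonoid.powers_le (P := coherentSubmonoid g)).mpr hσ
    (mem_powers_iff_mem_zpowers.mpr (inv_mem (Subgroup.mem_zpowers σ)))

variable [Finite α]

theorem self_mem_coherentSubgroup (g : Perm α) : g ∈ coherentSubgroup g := by
  refine ⟨fun x => ⟨1, by simp⟩, fun p _ i x => ?_⟩
  rw [← mul_apply, ← mul_apply, ← pow_succ, ← pow_succ']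

/-- The elements of `coherentSubgroup g` preserving every orbit of `g ^ m`. -/
def coherentSubgroup.orbitKernel (g : Perm α) (m : ℕ) : Subgroup (coherentSubgroup g) where
  carrier := {σ | ∀ x, (g ^ m).SameCycle x (σ.1 x)}
  one_mem' _ := SameCycle.refl _ _
  mul_mem' {_ τ} hσ hτ x := (hτ x).trans (hσ (τ.1 x))
  inv_mem' {σ} hσ x := by simpa using (hσ (σ.1⁻¹ x)).symm

theorem eq_of_forall_prime_sameCycle (hxy : g.SameCycle x y)
    (h : ∀ p ∈ (orderOf g).primeFactors, (g ^ ordProj[p] (orderOf g)).SameCycle x y) : x = y := by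
  obtain ⟨k, rfl⟩ := hxy.exists_nat_pow_eq
  have hper (t : ℤ) : (g ^ t) x = x ↔ (Function.minimalPeriod (g • ·) x : ℤ) ∣ t :=
    MulAction.zpow_smul_eq_iff_minimalPeriod_dvd (a := g) (b := x)
  have hord : Function.minimalPeriod (g • ·) x ∣ orderOf g := by
    have := (hper (orderOf g)).mp (by simp [pow_orderOf_eq_one])
    exact_mod_cast this
  suffices Function.minimalPeriod (g • ·) x ∣ k by
    have := (hper k).mpr (by exact_mod_cast this)
    simpa using this.symm
  rw [Nat.dvd_iff_prime_pow_dvd_dvd]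
  intro p j hp hj
  rcases Nat.eq_zero_or_pos j with rfl | hj0
  · simp
  have hjo := hj.trans hord
  have ho : orderOf g ≠ 0 := (orderOf_pos g).ne'
  obtain ⟨s, hs⟩ := sameCycle_pow_iff.mp
    (h p (Nat.mem_primeFactors.mpr ⟨hp, (dvd_pow_self p hj0.ne').trans hjo, ho⟩))
  have h1 := (hper (k - (ordProj[p] (orderOf g) : ℕ) * s)).mp (by
    rw [sub_eq_neg_add, zpow_add, mul_apply, zpow_natCast, ← hs, ← mul_apply, ← zpow_add,
      neg_add_cancel, zpow_zero, one_apply])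
  have h2 : ((p ^ j : ℕ) : ℤ) ∣ (ordProj[p] (orderOf g) : ℕ) * s := by
    refine Dvd.dvd.mul_right ?_ s
    exact Int.natCast_dvd_natCast.mpr
      (pow_dvd_pow p ((hp.pow_dvd_iff_le_factorization ho).mp hjo))
  exact Int.natCast_dvd_natCast.mp
    ((dvd_sub_left h2).mp ((Int.natCast_dvd_natCast.mpr hj).trans h1))

theorem isNilpotent_coherentSubgroup (g : Perm α) : Group.IsNilpotent (coherentSubgroup g) := by
  have hnormal (p : (orderOf g).primeFactors) :
      (coherentSubgroup.orbitKernel g (ordProj[p] (orderOf g))).Normal := by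
    refine ⟨fun σ hσ τ x => ?_⟩
    have := (hσ (τ.1⁻¹ x)).apply_of_mem_coherentSubmonoid
      (Nat.prime_of_mem_primeFactors p.2) τ.2
    simpa using this
  have hnilp (p : (orderOf g).primeFactors) : Group.IsNilpotent
      (coherentSubgroup g ⧸ coherentSubgroup.orbitKernel g (ordProj[p] (orderOf g))) := by
    have hp := Nat.prime_of_mem_primeFactors p.2
    have := Fact.mk hp
    refine IsPGroup.isNilpotent (p := p) fun q => ?_
    obtain ⟨σ, rfl⟩ := QuotientGroup.mk_surjective q
    refine ⟨(orderOf g).factorization p, ?_⟩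
    rw [← QuotientGroup.mk_pow, QuotientGroup.eq_one_iff]
    exact fun x => sameCycle_pow_prime_pow_apply hp σ.2 _ x
  refine Subgroup.isNilpotent_of_ker_le_center (MonoidHom.pi fun p : (orderOf g).primeFactors =>
    QuotientGroup.mk' (coherentSubgroup.orbitKernel g (ordProj[p] (orderOf g)))) ?_
  intro σ hσ
  suffices σ = 1 from this ▸ one_mem _
  ext x
  refine (eq_of_forall_prime_sameCycle (σ.2.1 x) fun p hp => ?_).symm
  exact (QuotientGroup.eq_one_iff σ).mp (congrFun hσ ⟨p, hp⟩) x

section Containment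

variable {M : Subgroup (Perm α)} [Group.IsNilpotent M]

/-- A `p'`-element of a nilpotent group containing `g` and preserving the orbits of `g` preserves
the orbits of `g ^ p ^ a` as well. -/
theorem sameCycle_pow_apply_of_coprime (hg : g ∈ M) (hM : ∀ σ ∈ M, ∀ x, g.SameCycle x (σ x))
    {p : ℕ} (hp : p.Prime) (hσ : σ ∈ M) (hpow : σ ^ ordCompl[p] (Nat.card M) = 1) (a : ℕ)
    (x : α) : (g ^ p ^ a).SameCycle x (σ x) := by
  have hclosed : ∀ σ ∈ M, ∀ τ ∈ M, σ ^ ordCompl[p] (Nat.card M) = 1 →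
      τ ^ ordCompl[p] (Nat.card M) = 1 → (σ * τ) ^ ordCompl[p] (Nat.card M) = 1 := by
    intro σ hσ τ hτ h1 h2
    have := Group.IsNilpotent.mul_pow_ordCompl_eq_one hp
      (x := (⟨σ, hσ⟩ : M)) (y := ⟨τ, hτ⟩) (Subtype.ext h1) (Subtype.ext h2)
    exact congrArg Subtype.val this
  set N := ordCompl[p] (Nat.card M) with hN
  have hcop : Nat.Coprime N (p ^ a) :=
    ((Nat.coprime_ordCompl hp Nat.card_pos.ne').pow_left a).symm
  refine Subgroup.induction_of_isNilpotent (M := M)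
    (P := fun σ => σ ^ N = 1 → ∀ x, (g ^ p ^ a).SameCycle x (σ x))
    (fun _ _ => SameCycle.refl _ _) ?_ hσ hpow x
  intro Z Z' hZ' hcomm hZ
  have key : ∀ σ ∈ Z', σ ^ N = 1 → ∀ x, (g ^ p ^ a).SameCycle (σ (g x)) (g (σ x)) := by
    intro σ hσ hσN x
    have h1 : (σ * g * σ⁻¹ * g⁻¹) ^ N = 1 := by
      rw [mul_assoc, mul_assoc, ← mul_assoc g]
      refine hclosed _ (hZ' hσ) _ (M.mul_mem (M.mul_mem hg (inv_mem (hZ' hσ))) (inv_mem hg))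
        hσN ?_
      rw [conj_pow, inv_pow, hσN, inv_one, mul_one, mul_inv_cancel]
    simpa using (hZ _ (hcomm σ hσ g hg) h1 (g (σ x))).symm
  intro σ hσ hσN x
  obtain ⟨k, hk⟩ := hM σ (hZ' hσ) x
  have h := sameCycle_pow_apply_iterate (σ := σ) (d := 1) (m := p ^ a) (k := k) (x := x)
    (fun t y => by
      rw [pow_one]
      exact key _ (pow_mem hσ t) (by rw [← pow_mul, mul_comm, pow_mul, hσN, one_pow]) y)
    (by simpa using hk.symm) N
  rw [hσN, one_apply, Nat.cast_one, one_mul] at h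
  rw [← hk]
  exact sameCycle_pow_zpow_of_isCoprime (Nat.isCoprime_iff_coprime.mpr hcop) h

theorem SameCycle.pow_apply_of_isNilpotent (hg : g ∈ M)
    (hM : ∀ σ ∈ M, ∀ x, g.SameCycle x (σ x)) {p : ℕ} (hp : p.Prime) (hσ : σ ∈ M) {a : ℕ}
    (ha : (Nat.card M).factorization p ≤ a) (h : (g ^ p ^ a).SameCycle x y) :
    (g ^ p ^ a).SameCycle (σ x) (σ y) := by
  obtain ⟨s, rfl⟩ := sameCycle_pow_iff.mp h
  set τ := g ^ ((p ^ a : ℕ) * s : ℤ) with hτ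
  have hτM : τ ∈ M := zpow_mem hg _
  have hcard : Nat.card M ∣ p ^ a * ordCompl[p] (Nat.card M) := by
    conv_lhs => rw [← Nat.ordProj_mul_ordCompl_eq_self (Nat.card M) p]
    exact Nat.mul_dvd_mul_right (pow_dvd_pow p ha) _
  have hτN : τ ^ ordCompl[p] (Nat.card M) = 1 := by
    obtain ⟨c, hc⟩ := (M.orderOf_dvd_natCard hg).trans hcard
    rw [hτ, ← zpow_natCast, ← zpow_mul, mul_right_comm, ← Nat.cast_mul, zpow_mul, zpow_natCast,
      hc, pow_mul, pow_orderOf_eq_one, one_pow, one_zpow]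
  have := sameCycle_pow_apply_of_coprime hg hM hp (σ := σ * τ * σ⁻¹)
    (M.mul_mem (M.mul_mem hσ hτM) (inv_mem hσ)) (by rw [conj_pow, hτN]; simp) a (σ x)
  simpa using this

/-- A nilpotent permutation group containing `g` and preserving all orbits of `g` is contained
in `coherentSubgroup g`. -/
theorem le_coherentSubgroup (hg : g ∈ M) (hM : ∀ σ ∈ M, ∀ x, g.SameCycle x (σ x)) :
    M ≤ coherentSubgroup g := by
  suffices ∀ p : ℕ, p.Prime → ∀ i : ℕ,
      (∀ σ ∈ M, ∀ x y, (g ^ p ^ i).SameCycle x y → (g ^ p ^ i).SameCycle (σ x) (σ y)) ∧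
      ∀ σ ∈ M, ∀ x, (g ^ p ^ (i + 1)).SameCycle (σ ((g ^ p ^ i) x)) ((g ^ p ^ i) (σ x)) from
    fun σ hσ => ⟨hM σ hσ, fun p hp i x => (this p hp i).2 σ hσ x⟩
  intro p hp i
  have hstep : ∀ i : ℕ,
      (∀ σ ∈ M, ∀ x y, (g ^ p ^ i).SameCycle x y → (g ^ p ^ i).SameCycle (σ x) (σ y)) →
      ∀ σ ∈ M, ∀ x, (g ^ p ^ (i + 1)).SameCycle (σ ((g ^ p ^ i) x)) ((g ^ p ^ i) (σ x)) := by
    intro i hi σ hσ x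
    set a := (Nat.card M).factorization p + i + 1
    have hia : i ≤ a := by omega
    have hpres : ∀ σ ∈ M, ∀ x y, (g ^ p ^ a).SameCycle x y → (g ^ p ^ a).SameCycle (σ x) (σ y) :=
      fun σ hσ x y h => h.pow_apply_of_isNilpotent hg hM hp hσ (by omega)
    let stab (j : ℕ) (hj : ∀ σ ∈ M, ∀ x y, (g ^ p ^ j).SameCycle x y →
        (g ^ p ^ j).SameCycle (σ x) (σ y)) : Subgroup (Perm α) :=
      { carrier := {τ | τ ∈ M ∧ (g ^ p ^ j).SameCycle x (τ x)}
        one_mem' := ⟨one_mem _, SameCycle.refl _ _⟩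
        mul_mem' := fun {σ τ} hσ hτ =>
          ⟨mul_mem hσ.1 hτ.1, hσ.2.trans (hj σ hσ.1 _ _ hτ.2)⟩
        inv_mem' := fun {σ} hσ =>
          ⟨inv_mem hσ.1, by simpa using (hj σ⁻¹ (inv_mem hσ.1) _ _ hσ.2).symm⟩ }
    let T := stab i hi
    let S := stab a hpres
    have hTM : T ≤ M := fun τ hτ => hτ.1
    have : Group.IsNilpotent T :=
      Subgroup.isNilpotent_of_ker_le_center (Subgroup.inclusion hTM)
        (by rw [(MonoidHom.ker_eq_bot_iff _).mpr (Subgroup.inclusion_injective hTM)]; exact bot_le)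
    have hST : S ≤ T := fun τ hτ => ⟨hτ.1, hτ.2.of_pow_dvd (pow_dvd_pow p hia)⟩
    have hgT : g ^ p ^ i ∈ T :=
      ⟨pow_mem hg _, 1, by rw [zpow_one]⟩
    obtain ⟨k, hk⟩ := hM σ hσ x
    have hρx : (g ^ (-k) * σ) x = x := by
      rw [mul_apply, ← hk, ← mul_apply, ← zpow_add, neg_add_cancel, zpow_zero, one_apply]
    have hρS : g ^ (-k) * σ ∈ S :=
      ⟨mul_mem (zpow_mem hg _) hσ, by rw [hρx]⟩
    obtain ⟨s, ⟨c, rfl⟩, hs⟩ := Group.IsNilpotent.exists_dvd_zpow_mul_conj_mem hp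
      (S := S.subgroupOf T) (h := ⟨g ^ p ^ i, hgT⟩) (a := a) (ρ := ⟨_, hST hρS⟩)
      (fun τ => by
        obtain ⟨s, hs⟩ := τ.2.2
        refine ⟨-s, mul_mem (zpow_mem (pow_mem hg _) _) (hTM τ.2), ?_⟩
        simpa [← hs] using SameCycle.refl _ _)
      ⟨pow_mem (pow_mem hg _) _, by
        rw [Subgroup.coe_subtype, Subgroup.coe_pow, ← pow_mul, mul_comm, pow_mul,
          sameCycle_pow_right]⟩
      hρS
    have h1 := SameCycle.of_pow_dvd (pow_dvd_pow p (show i + 1 ≤ a by omega)) hs.2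
    simp only [Subgroup.coe_subtype, Subgroup.coe_mul, Subgroup.coe_zpow, Subgroup.coe_inv,
      mul_apply] at h1
    rw [zpow_mul, zpow_natCast, ← pow_mul, ← pow_succ, sameCycle_zpow_right,
      ← sameCycle_pow_zpow_apply (p ^ i : ℕ), ← sameCycle_pow_zpow_apply k] at h1
    have e1 : (g ^ k) ((g ^ ((p ^ i : ℕ) : ℤ)) x) = (g ^ p ^ i) (σ x) := by
      rw [← hk, zpow_natCast, ← zpow_natCast, ← mul_apply, ← mul_apply, ← zpow_add, ← zpow_add,
        add_comm]
    rw [e1] at h1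
    rw [zpow_natCast, ← mul_apply _ (g ^ p ^ i)⁻¹, mul_inv_cancel, one_apply, ← mul_apply (g ^ k),
      ← zpow_add, add_neg_cancel, zpow_zero, one_apply] at h1
    exact h1.symm
  induction i with
  | zero =>
    have h0 : ∀ σ ∈ M, ∀ x y, (g ^ p ^ 0).SameCycle x y → (g ^ p ^ 0).SameCycle (σ x) (σ y) := by
      intro σ hσ x y h
      rw [pow_zero, pow_one] at h ⊢
      exact ((hM σ hσ x).symm.trans h).trans (hM σ hσ y)
    exact ⟨h0, hstep 0 h0⟩
  | succ i ih =>
    have h0 : ∀ σ ∈ M, ∀ x y, (g ^ p ^ (i + 1)).SameCycle x y →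
        (g ^ p ^ (i + 1)).SameCycle (σ x) (σ y) :=
      fun σ hσ x y h => h.pow_apply_of_comm (pow_dvd_pow p i.le_succ) (ih.2 σ hσ)
    exact ⟨h0, hstep (i + 1) h0⟩

end Containment

end Equiv.Perm

theorem distinct_cycle_type_unique_maximal_nilpotent {n : ℕ}
    (g : Equiv.Perm (Fin n))
    (hdist : ∀ x y : Fin n,
      Nat.card {z : Fin n // g.SameCycle x z} = Nat.card {z : Fin n // g.SameCycle y z} →
        g.SameCycle x y) :
    ∃! N : Subgroup (Equiv.Perm (Fin n)),
      Group.IsNilpotent N ∧ g ∈ N ∧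
        ∀ M : Subgroup (Equiv.Perm (Fin n)), Group.IsNilpotent M → N ≤ M → M = N := by
  have hle : ∀ M : Subgroup (Equiv.Perm (Fin n)), Group.IsNilpotent M → g ∈ M →
      M ≤ g.coherentSubgroup := fun M _ hg =>
    Equiv.Perm.le_coherentSubgroup hg fun _ hσ =>
      Equiv.Perm.sameCycle_apply_of_isNilpotent hg hdist hσ
  have hnil := Equiv.Perm.isNilpotent_coherentSubgroup g
  have hmem := Equiv.Perm.self_mem_coherentSubgroup g
  exact ⟨g.coherentSubgroup, ⟨hnil, hmem, fun M hM h => (hle M hM (h hmem)).antisymm h⟩,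
    fun N ⟨hN, hgN, hmax⟩ => (hmax _ hnil (hle N hN hgN)).symm⟩
end
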